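/- Let ν be a finite Borel measure on ℝⁿ such that for each standard basis vector e_i (i = 1,…,n) there exists a ν-integrable function β_i : ℝⁿ → ℝ with ∫ ∂φ/∂x_i (x) ν(dx) = -∫ φ(x) β_i(x) ν(dx) for every smooth compactly supported function φ : ℝⁿ → ℝ. Then ν is absolutely continuous with respect to the Lebesgue measure on ℝⁿ, i.e. ν = ψ_ν · λ for some nonnegative Lebesgue-integrable density ψ_ν. -/

import Mathlib

open MeasureTheory

lemma logDeriv_shift
    {n : ℕ} (ν : Measure (EuclideanSpace ℝ (Fin n))) [IsFiniteMeasure ν]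
    (β : Fin n → EuclideanSpace ℝ (Fin n) → ℝ)
    (hβint : ∀ i, Integrable (β i) ν)
    (hIBP : ∀ i : Fin n, ∀ φ : EuclideanSpace ℝ (Fin n) → ℝ,
      ContDiff ℝ (⊤ : ℕ∞) φ → HasCompactSupport φ →
      ∫ x, fderiv ℝ φ x (EuclideanSpace.single i (1:ℝ)) ∂ν = -∫ x, φ x * β i x ∂ν)
    (φ : EuclideanSpace ℝ (Fin n) → ℝ) (hφ : ContDiff ℝ (⊤ : ℕ∞) φ) (hc : HasCompactSupport φ)
    (h1 : ∀ x, |φ x| ≤ 1) (h : EuclideanSpace ℝ (Fin n)) :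
    |∫ x, φ (x + h) ∂ν - ∫ x, φ x ∂ν| ≤ (∑ i, ∫ x, |β i x| ∂ν) * ‖h‖ := by
  have hcd : Continuous (fderiv ℝ φ) := hφ.continuous_fderiv (by simp)
  have hcs : HasCompactSupport (fderiv ℝ φ) := hc.fderiv (𝕜 := ℝ)
  obtain ⟨M, hM⟩ := hcs.exists_bound_of_continuous hcd
  have hint : ∀ (v w : EuclideanSpace ℝ (Fin n)), Integrable (fun x => fderiv ℝ φ (x + v) w) ν := by
    intro v w
    refine Integrable.of_bound (C := M * ‖w‖) ?_ ?_
    · exact Continuous.aestronglyMeasurable (by fun_prop)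
    · exact Filter.Eventually.of_forall fun x =>
        (ContinuousLinearMap.le_opNorm _ _).trans (by gcongr; exact hM _)
  have hd : ∀ t : ℝ, HasDerivAt (fun t : ℝ => ∫ x, φ (x + t • h) ∂ν)
      (∫ x, fderiv ℝ φ (x + t • h) h ∂ν) t := by
    intro t
    refine (hasDerivAt_integral_of_dominated_loc_of_deriv_le (μ := ν) (s := Set.univ)
      (bound := fun _ => M * ‖h‖) (F := fun t x => φ (x + t • h))
      (F' := fun t x => fderiv ℝ φ (x + t • h) h) Filter.univ_mem ?_ ?_ ?_ ?_ ?_ ?_).2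
    · exact Filter.Eventually.of_forall fun s =>
        (hφ.continuous.comp (by fun_prop)).aestronglyMeasurable
    · refine Integrable.of_bound (C := 1) (hφ.continuous.comp (by fun_prop)).aestronglyMeasurable ?_
      exact Filter.Eventually.of_forall fun x => h1 _
    · exact (hint _ _).aestronglyMeasurable
    · exact Filter.Eventually.of_forall fun x s _ =>
        (ContinuousLinearMap.le_opNorm _ _).trans (by gcongr; exact hM _)
    · exact integrable_const _
    · refine Filter.Eventually.of_forall fun x s _ => ?_
      have e1 : HasFDerivAt φ (fderiv ℝ φ (x + s • h)) (x + s • h) :=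
        (hφ.differentiable (by simp) _).hasFDerivAt
      have e2 : HasDerivAt (fun s : ℝ => x + s • h) h s := by
        simpa using ((hasDerivAt_id s).smul_const h).const_add x
      exact e1.comp_hasDerivAt s e2
  have hb : ∀ t : ℝ, ‖∫ x, fderiv ℝ φ (x + t • h) h ∂ν‖ ≤ (∑ i, ∫ x, |β i x| ∂ν) * ‖h‖ := by
    intro t
    have hh : h = ∑ i, h i • EuclideanSpace.single i (1:ℝ) := by
      ext j
      simp [Finset.sum_apply, Pi.single_apply]
    have e : ∀ x, fderiv ℝ φ (x + t • h) h
        = ∑ i, h i * fderiv ℝ φ (x + t • h) (EuclideanSpace.single i (1:ℝ)) := by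
      intro x
      have e0 := congrArg (fderiv ℝ φ (x + t • h)) hh
      rw [map_sum] at e0
      simpa only [map_smul, smul_eq_mul] using e0
    simp_rw [e]
    rw [integral_finset_sum _ (fun i _ => (hint _ _).const_mul _), Finset.sum_mul]
    refine (norm_sum_le _ _).trans (Finset.sum_le_sum fun i _ => ?_)
    rw [integral_const_mul]
    have e3 := hIBP i (fun x => φ (x + t • h)) (hφ.comp (by fun_prop))
      (hc.comp_homeomorph (Homeomorph.addRight (t • h)))
    simp_rw [fderiv_comp_add_right] at e3
    rw [e3, norm_mul, norm_neg, mul_comm]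
    gcongr
    · refine (norm_integral_le_of_norm_le (hβint i).abs (Filter.Eventually.of_forall fun x => ?_))
      rw [norm_mul]
      exact mul_le_of_le_one_left (abs_nonneg _) (h1 _)
    · exact PiLp.norm_apply_le h i
  have := Convex.norm_image_sub_le_of_norm_hasDerivWithin_le (s := Set.univ)
    (fun t _ => (hd t).hasDerivWithinAt) (fun t _ => hb t) convex_univ
    (Set.mem_univ (0:ℝ)) (Set.mem_univ (1:ℝ))
  simpa using this

lemma logDeriv_compact
    {n : ℕ} (ν : Measure (EuclideanSpace ℝ (Fin n))) [IsFiniteMeasure ν]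
    (β : Fin n → EuclideanSpace ℝ (Fin n) → ℝ)
    (hβint : ∀ i, Integrable (β i) ν)
    (hIBP : ∀ i : Fin n, ∀ φ : EuclideanSpace ℝ (Fin n) → ℝ,
      ContDiff ℝ (⊤ : ℕ∞) φ → HasCompactSupport φ →
      ∫ x, fderiv ℝ φ x (EuclideanSpace.single i (1:ℝ)) ∂ν = -∫ x, φ x * β i x ∂ν)
    (K : Set (EuclideanSpace ℝ (Fin n))) (hK : IsCompact K) (hK0 : volume K = 0) : ν K = 0 := by
  have hae : ∀ᵐ h : EuclideanSpace ℝ (Fin n), ∀ᵐ x ∂ν, x + h ∉ K := by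
    rw [Measure.ae_ae_comm]
    · refine Filter.Eventually.of_forall fun x => ?_
      have : volume ((fun h => x + h) ⁻¹' K) = 0 := by rw [measure_preimage_add, hK0]
      exact measure_eq_zero_iff_ae_notMem.1 this
    · exact (hK.isClosed.preimage (f := fun p : EuclideanSpace ℝ (Fin n) × EuclideanSpace ℝ (Fin n)
        => p.2 + p.1) (by fun_prop)).isOpen_compl.measurableSet
  have hdense := Measure.dense_of_ae hae
  set C := ∑ i, ∫ x, |β i x| ∂ν with hC
  have hC0 : 0 ≤ C := Finset.sum_nonneg fun i _ => integral_nonneg fun x => abs_nonneg _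
  have key : ∀ ε : ℝ, 0 < ε → ν.real K ≤ ε + C * ε := by
    intro ε hε
    obtain ⟨h, hh, hhε⟩ := hdense.exists_dist_lt 0 hε
    rw [dist_zero_left] at hhε
    let ν' := ν.map (fun x => x + h)
    have hm : Measurable (fun x : EuclideanSpace ℝ (Fin n) => x + h) := by fun_prop
    have hν'K : ν' K = 0 := by
      rw [Measure.map_apply hm hK.measurableSet]
      exact measure_eq_zero_iff_ae_notMem.2 hh
    haveI : IsFiniteMeasure ν' := Measure.isFiniteMeasure_map ν _
    obtain ⟨U, hKU, hUo, hU⟩ := K.exists_isOpen_lt_of_lt (μ := ν') (ENNReal.ofReal ε)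
      (by rw [hν'K]; simpa using hε)
    let V := U ∩ Metric.thickening 1 K
    have hVo : IsOpen V := hUo.inter Metric.isOpen_thickening
    have hKV : K ⊆ V := Set.subset_inter hKU (Metric.self_subset_thickening one_pos K)
    obtain ⟨f, hf0, hf1, hf⟩ := exists_contMDiffMap_zero_one_of_isClosed (n := (⊤ : ℕ∞))
      (modelWithCornersSelf ℝ (EuclideanSpace ℝ (Fin n))) hVo.isClosed_compl hK.isClosed
      (Set.disjoint_left.2 fun x hx hx' => hx (hKV hx'))
    have hfc : HasCompactSupport f := by
      refine HasCompactSupport.of_support_subset_isCompact (K := Metric.cthickening 1 K)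
        hK.cthickening fun x hx => ?_
      by_contra hxV
      exact hx (hf0 fun hv => hxV (Metric.thickening_subset_cthickening _ _ hv.2))
    have hfs : ContDiff ℝ (⊤ : ℕ∞) f := f.contMDiff.contDiff
    have hs := logDeriv_shift ν β hβint hIBP f hfs hfc
      (fun x => abs_le.2 ⟨by linarith [(hf x).1], (hf x).2⟩) h
    have hi : ∀ μ : Measure (EuclideanSpace ℝ (Fin n)), IsFiniteMeasure μ → Integrable f μ := by
      intro μ _
      exact hfs.continuous.integrable_of_hasCompactSupport hfc
    have a1 : ν.real K ≤ ∫ x, f x ∂ν := by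
      rw [← integral_indicator_one hK.measurableSet]
      refine integral_mono ((integrable_const 1).indicator hK.measurableSet) (hi ν inferInstance) ?_
      intro x
      by_cases hx : x ∈ K
      · simp [hx, hf1 hx]
      · simp [hx, (hf x).1]
    have a2 : ∫ x, f (x + h) ∂ν ≤ ε := by
      have : ∫ x, f (x + h) ∂ν = ∫ x, f x ∂ν' :=
        (integral_map hm.aemeasurable hfs.continuous.aestronglyMeasurable).symm
      rw [this]
      have a3 : ∫ x, f x ∂ν' ≤ ν'.real U := by
        rw [← integral_indicator_one hUo.measurableSet]
        refine integral_mono (hi ν' inferInstance)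
          ((integrable_const 1).indicator hUo.measurableSet) ?_
        intro x
        by_cases hx : x ∈ U
        · simp [hx, (hf x).2]
        · have : f x = 0 := hf0 (fun hv => hx hv.1)
          simp [hx, this]
      exact a3.trans (ENNReal.toReal_le_of_le_ofReal hε.le hU.le)
    have a4 : C * ‖h‖ ≤ C * ε := by gcongr
    have := (abs_le.1 hs).1
    linarith
  have h0 : ν.real K ≤ 0 := by
    refine le_of_forall_pos_le_add fun δ hδ => ?_
    have := key (δ / (1 + C)) (by positivity)
    have e : δ / (1 + C) + C * (δ / (1 + C)) = δ := by field_simp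
    linarith
  exact (measureReal_eq_zero_iff).1 (le_antisymm h0 measureReal_nonneg)

/-- Section 3 of the paper: a finite Borel measure `ν` on `ℝⁿ` possessing a logarithmic
derivative `β_i ∈ L¹(ν)` along each basis direction `e_i` (in the sense of the
integration-by-parts formula on smooth compactly supported test functions) is absolutely
continuous with respect to Lebesgue measure, i.e. `ν = ψ_ν · λ` for some nonnegative
Lebesgue-integrable density `ψ_ν`. -/
theorem measure_with_logDeriv_is_absolutely_continuous
    {n : ℕ} (ν : Measure (EuclideanSpace ℝ (Fin n))) [IsFiniteMeasure ν]
    (β : Fin n → EuclideanSpace ℝ (Fin n) → ℝ)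
    (hβint : ∀ i, Integrable (β i) ν)
    (hIBP : ∀ i : Fin n, ∀ φ : EuclideanSpace ℝ (Fin n) → ℝ,
      ContDiff ℝ (⊤ : ℕ∞) φ → HasCompactSupport φ →
      ∫ x, fderiv ℝ φ x (EuclideanSpace.single i (1:ℝ)) ∂ν = -∫ x, φ x * β i x ∂ν) :
    ν ≪ (volume : Measure (EuclideanSpace ℝ (Fin n))) ∧
    ∃ ψ : EuclideanSpace ℝ (Fin n) → ℝ, (∀ x, 0 ≤ ψ x) ∧ Integrable ψ volume ∧
      ν = volume.withDensity fun x => ENNReal.ofReal (ψ x) := by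
  have hac : ν ≪ (volume : Measure (EuclideanSpace ℝ (Fin n))) := by
    refine Measure.AbsolutelyContinuous.mk fun s hs hs0 => ?_
    rw [hs.measure_eq_iSup_isCompact]
    simp only [ENNReal.iSup_eq_zero]
    intro K hKs hK
    exact logDeriv_compact ν β hβint hIBP K hK (measure_mono_null hKs hs0)
  refine ⟨hac, fun x => (ν.rnDeriv volume x).toReal, fun x => ENNReal.toReal_nonneg,
    Measure.integrable_toReal_rnDeriv, ?_⟩
  conv_lhs => rw [← Measure.withDensity_rnDeriv_eq ν volume hac]
  refine withDensity_congr_ae ?_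
  filter_upwards [Measure.rnDeriv_lt_top ν volume] with x hx
  rw [ENNReal.ofReal_toReal hx.ne]
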